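/- There is no four-term arithmetic progression of distinct integer squares: there do not exist integers a and d with d ≠ 0 such that a, a + d, a + 2d, and a + 3d are all squares of integers. -/

import Mathlib

theorem sq_odd8 (x : ℤ) (h : x % 2 = 1) : x ^ 2 % 8 = 1 := by
  have : x % 8 = 1 ∨ x % 8 = 3 ∨ x % 8 = 5 ∨ x % 8 = 7 := by omega
  rcases this with h | h | h | h <;> simp [pow_two, Int.mul_emod, h]

theorem sq_even4 (x : ℤ) (h : x % 2 = 0) : x ^ 2 % 4 = 0 := by
  have : x % 4 = 0 ∨ x % 4 = 2 := by omega
  rcases this with h | h <;> simp [pow_two, Int.mul_emod, h]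

theorem sq_three (x : ℤ) (h : ¬ (3 : ℤ) ∣ x) : x ^ 2 % 3 = 1 := by
  have : x % 3 = 1 ∨ x % 3 = 2 := by omega
  rcases this with h | h <;> simp [pow_two, Int.mul_emod, h]

theorem natAbs_lt_aux (x y e : ℤ) (he : e ≠ 0) (h : e = 2 * (x * y)) :
    x ≠ 0 ∧ x.natAbs < e.natAbs := by
  have hx : x ≠ 0 := by rintro rfl; simp at h; exact he h
  have hy : y ≠ 0 := by rintro rfl; simp at h; exact he h
  refine ⟨hx, ?_⟩
  rw [h, Int.natAbs_mul, Int.natAbs_mul]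
  have h1 : 0 < x.natAbs := Int.natAbs_pos.mpr hx
  have h2 : 0 < y.natAbs := Int.natAbs_pos.mpr hy
  rw [show (2 : ℤ).natAbs = 2 from rfl]
  nlinarith

theorem core (e p q r s : ℤ) (he : e ≠ 0) (hepq : e = 2 * (p * q)) (hpq : IsCoprime p q)
    (hrs : IsCoprime (3 * r) s) (hpar : (p % 2 = 0 ∧ q % 2 = 1) ∨ (p % 2 = 1 ∧ q % 2 = 0))
    (hpar2 : ((3 * r) % 2 = 0 ∧ s % 2 = 1) ∨ ((3 * r) % 2 = 1 ∧ s % 2 = 0))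
    (hprod : p * q = r * s) (hsum : p ^ 2 + q ^ 2 = (3 * r) ^ 2 + s ^ 2) :
    ∃ f e' v u : ℤ, e' ≠ 0 ∧ e'.natAbs < e.natAbs ∧ f ^ 2 = v ^ 2 + e' ^ 2 ∧
      f ^ 2 = u ^ 2 + 9 * e' ^ 2 := by
  obtain ⟨a, c, ⟨b, rfl⟩, ⟨d, rfl⟩, rfl⟩ := exists_dvd_and_dvd_of_dvd_mul (Dvd.intro s hprod.symm)
  have hac : a * c ≠ 0 := by
    intro h
    apply he
    rw [hepq, hprod, h]; simp
  have hs : s = b * d := by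
    apply mul_left_cancel₀ hac
    rw [← hprod]; ring
  subst hs
  have ha0 : a ≠ 0 := left_ne_zero_of_mul hac
  have had : IsCoprime (a ^ 2) (d ^ 2) :=
    (hpq.of_mul_left_left.of_mul_right_right).pow
  have hbc : IsCoprime (b ^ 2) (c ^ 2) :=
    (hpq.of_mul_left_right.of_mul_right_left).pow
  have hkey : a ^ 2 * (b ^ 2 - 9 * c ^ 2) = d ^ 2 * (b ^ 2 - c ^ 2) := by linear_combination hsum
  obtain ⟨k, hk⟩ : a ^ 2 ∣ b ^ 2 - c ^ 2 := had.dvd_of_dvd_mul_left (Dvd.intro _ hkey)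
  have hk2 : b ^ 2 - 9 * c ^ 2 = d ^ 2 * k := by
    apply mul_left_cancel₀ (pow_ne_zero 2 ha0)
    rw [hkey, hk]; ring
  have hk8 : k ∣ 8 := by
    obtain ⟨x, y, hxy⟩ := hbc
    refine ⟨x * (9 * a ^ 2 - d ^ 2) + y * (a ^ 2 - d ^ 2), ?_⟩
    linear_combination (-8) * hxy + (9 * x + y) * hk - (x + y) * hk2
  have h3 : IsCoprime 3 (b * d) := hrs.of_mul_left_left
  have h3' : ¬ (3 : ℤ) ∣ b * d := by
    intro h
    have := h3.isUnit_of_dvd' dvd_rfl h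
    rw [Int.isUnit_iff] at this
    omega
  have hb3 := sq_three b (fun h => h3' (h.mul_right d))
  have hd3 := sq_three d (fun h => h3' (h.mul_left b))
  have hkle : k ≤ 8 := Int.le_of_dvd (by norm_num) hk8
  have hkge : -k ≤ 8 := Int.le_of_dvd (by norm_num) ((neg_dvd).mpr hk8)
  have hkl : k = 1 ∨ k = -1 ∨ k = 2 ∨ k = -2 ∨ k = 4 ∨ k = -4 ∨ k = 8 ∨ k = -8 := by
    have : -8 ≤ k := by omega
    interval_cases k <;> revert hk8 <;> decide
  have hcases : (k = 1 ∧ c % 2 = 0) ∨ (k = -8 ∧ a % 2 = 0) := by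
    have A := Int.emod_two_eq_zero_or_one a
    have B := Int.emod_two_eq_zero_or_one b
    have C := Int.emod_two_eq_zero_or_one c
    have D := Int.emod_two_eq_zero_or_one d
    have sa := sq_odd8 a
    have sb := sq_odd8 b
    have sc := sq_odd8 c
    have sd := sq_odd8 d
    have ta := sq_even4 a
    have tb := sq_even4 b
    have tc := sq_even4 c
    have td := sq_even4 d
    clear hkey hsum had hbc h3 h3' hpq hrs
    generalize a ^ 2 = a2 at *
    generalize b ^ 2 = b2 at *
    generalize c ^ 2 = c2 at *
    generalize d ^ 2 = d2 at *
    clear hprod hepq hac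
    rcases A with A | A <;> rcases B with B | B <;> rcases C with C | C <;>
      rcases D with D | D <;> simp [Int.mul_emod, A, B, C, D] at hpar hpar2 sa sb sc sd ta tb tc td <;>
      rcases hkl with rfl | rfl | rfl | rfl | rfl | rfl | rfl | rfl <;> omega
  rcases hcases with ⟨rfl, -⟩ | ⟨rfl, -⟩
  · obtain ⟨h1, h2⟩ := natAbs_lt_aux c (a * b * d) e he (by rw [hepq]; ring)
    exact ⟨b, c, a, d, h1, h2, by linarith, by linarith⟩
  · obtain ⟨h1, h2⟩ := natAbs_lt_aux a (b * c * d) e he (by rw [hepq]; ring)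
    exact ⟨d, a, c, b, h1, h2, by linarith, by linarith⟩

theorem descent (n : ℕ) : ∀ f e v u : ℤ, e.natAbs = n → e ≠ 0 → f ^ 2 = v ^ 2 + e ^ 2 →
    f ^ 2 = u ^ 2 + 9 * e ^ 2 → False := by
  induction n using Nat.strong_induction_on with
  | _ n ih =>
  intro f e v u hn he h1 h2
  subst hn
  wlog hf : 0 < f generalizing f
  · refine this (-f) (by linarith [neg_sq f]) (by linarith [neg_sq f]) ?_
    have : f ≠ 0 := by
      rintro rfl
      have : 0 < e ^ 2 := by positivity
      nlinarith [sq_nonneg v]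
    omega
  by_cases hg : Int.gcd f e = 1
  swap
  · obtain ⟨f', hf'⟩ := Int.gcd_dvd_left f e
    obtain ⟨e', he'⟩ := Int.gcd_dvd_right f e
    have hg0 : Int.gcd f e ≠ 0 := by
      intro h
      rw [Int.gcd_eq_zero_iff] at h
      exact he h.2
    generalize Int.gcd f e = g at *
    have hgz : (g : ℤ) ≠ 0 := by exact_mod_cast hg0
    have hv : (g : ℤ) ∣ v := by
      rw [← Int.pow_dvd_pow_iff (two_ne_zero)]
      exact ⟨f' ^ 2 - e' ^ 2, by rw [hf', he'] at h1; linear_combination -h1⟩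
    have hu : (g : ℤ) ∣ u := by
      rw [← Int.pow_dvd_pow_iff (two_ne_zero)]
      exact ⟨f' ^ 2 - 9 * e' ^ 2, by rw [hf', he'] at h2; linear_combination -h2⟩
    obtain ⟨v', rfl⟩ := hv
    obtain ⟨u', rfl⟩ := hu
    have he0 : e' ≠ 0 := by rintro rfl; simp at he'; exact he he'
    refine ih e'.natAbs ?_ f' e' v' u' rfl he0 ?_ ?_
    · rw [he', Int.natAbs_mul, Int.natAbs_natCast]
      have : 0 < e'.natAbs := Int.natAbs_pos.mpr he0
      have : 2 ≤ g := by omega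
      nlinarith
    · apply mul_left_cancel₀ (pow_ne_zero 2 hgz)
      rw [hf', he'] at h1; linear_combination h1
    · apply mul_left_cancel₀ (pow_ne_zero 2 hgz)
      rw [hf', he'] at h2; linear_combination h2
  have hco : IsCoprime f e := Int.isCoprime_iff_gcd_eq_one.mpr hg
  have h3f : IsCoprime f 3 := by
    have hp : Prime (3 : ℤ) := Int.prime_three
    rw [isCoprime_comm]
    refine (hp.coprime_iff_not_dvd).mpr fun h => ?_
    have he3 : ¬ (3 : ℤ) ∣ e := fun h' => hp.not_isUnit (hco.isUnit_of_dvd' h h')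
    have hf3 : (3 : ℤ) ∣ f ^ 2 := dvd_pow h two_ne_zero
    have := sq_three e he3
    by_cases hv : (3 : ℤ) ∣ v
    · have : (3 : ℤ) ∣ v ^ 2 := dvd_pow hv two_ne_zero
      omega
    · have := sq_three v hv
      omega
  have hpar : e % 2 = 0 ∧ v % 2 = 1 ∧ u % 2 = 1 := by
    have F := Int.emod_two_eq_zero_or_one f
    have E := Int.emod_two_eq_zero_or_one e
    have V := Int.emod_two_eq_zero_or_one v
    have U := Int.emod_two_eq_zero_or_one u
    have hfe : ¬ (f % 2 = 0 ∧ e % 2 = 0) := by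
      rintro ⟨a, b⟩
      exact Int.prime_two.not_isUnit
        (hco.isUnit_of_dvd' (Int.dvd_of_emod_eq_zero a) (Int.dvd_of_emod_eq_zero b))
    have := sq_odd8 f
    have := sq_odd8 e
    have := sq_odd8 v
    have := sq_odd8 u
    have := sq_even4 f
    have := sq_even4 e
    have := sq_even4 v
    have := sq_even4 u
    by_cases hE : e % 2 = 0
    · omega
    · exfalso
      have hV : v % 2 = 0 := by omega
      have hU : u % 2 = 0 := by omega
      obtain ⟨v', rfl⟩ := Int.dvd_of_emod_eq_zero hV
      obtain ⟨u', rfl⟩ := Int.dvd_of_emod_eq_zero hU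
      have V' := Int.emod_two_eq_zero_or_one v'
      have U' := Int.emod_two_eq_zero_or_one u'
      have := sq_odd8 v'
      have := sq_odd8 u'
      have := sq_even4 v'
      have := sq_even4 u'
      have h5 : v' ^ 2 = u' ^ 2 + 2 * e ^ 2 := by linarith
      omega
  obtain ⟨hE, hV, hU⟩ := hpar
  have t1 : PythagoreanTriple v e f := by unfold PythagoreanTriple; linarith
  have t2 : PythagoreanTriple u (3 * e) f := by unfold PythagoreanTriple; linarith
  have c1 : Int.gcd v e = 1 := by
    rw [← Int.isCoprime_iff_gcd_eq_one]
    have h : IsCoprime (v ^ 2 + e * e) e := by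
      rw [show v ^ 2 + e * e = f ^ 2 by linarith]; exact hco.pow_left
    have := IsCoprime.of_add_mul_left_left h
    exact (IsCoprime.pow_left_iff two_pos).mp this
  have c2 : Int.gcd u (3 * e) = 1 := by
    rw [← Int.isCoprime_iff_gcd_eq_one]
    have h : IsCoprime (u ^ 2 + (3 * e) * (3 * e)) (3 * e) := by
      rw [show u ^ 2 + (3 * e) * (3 * e) = f ^ 2 by linarith]
      exact (h3f.mul_right hco).pow_left
    have := IsCoprime.of_add_mul_left_left h
    exact (IsCoprime.pow_left_iff two_pos).mp this
  obtain ⟨p, q, -, hepq, hfpq, hpq, hpar1, -⟩ := t1.coprime_classification' c1 hV hf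
  obtain ⟨r, s, -, hers, hfrs, hrs, hpar2, -⟩ := t2.coprime_classification' c2 hU hf
  rw [← Int.isCoprime_iff_gcd_eq_one] at hpq hrs
  have hprod : 3 * (p * q) = r * s := by linarith
  have : ∃ f e' v u : ℤ, e' ≠ 0 ∧ e'.natAbs < e.natAbs ∧ f ^ 2 = v ^ 2 + e' ^ 2 ∧
      f ^ 2 = u ^ 2 + 9 * e' ^ 2 := by
    rcases Int.prime_three.dvd_or_dvd (Dvd.intro _ hprod) with ⟨r, rfl⟩ | ⟨s, rfl⟩
    · exact core e p q r s he (by linarith) hpq hrs hpar1 hpar2 (by linarith) (by linarith)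
    · exact core e p q s r he (by linarith) hpq hrs.symm hpar1 (by omega) (by linarith)
        (by linarith)
  obtain ⟨f', e', v', u', h0, hlt, h3, h4⟩ := this
  exact ih _ hlt f' e' v' u' rfl h0 h3 h4

theorem no_four_squares_in_AP :
    ¬ ∃ (a d : ℤ), d ≠ 0 ∧
      (∃ m : ℤ, a = m ^ 2) ∧ (∃ m : ℤ, a + d = m ^ 2) ∧
      (∃ m : ℤ, a + 2 * d = m ^ 2) ∧ (∃ m : ℤ, a + 3 * d = m ^ 2) := by
  rintro ⟨a, d, hd, ⟨x, hx⟩, ⟨y, hy⟩, ⟨z, hz⟩, ⟨w, hw⟩⟩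
  -- `f = 2a + 3d`, `e = d`, `v = 2yz`, `u = 2xw`
  refine descent _ (2 * a + 3 * d) d (2 * (y * z)) (2 * (x * w)) rfl hd ?_ ?_
  · have : (2 * (y * z)) ^ 2 = 4 * ((a + d) * (a + 2 * d)) := by rw [hy, hz]; ring
    rw [this]; ring
  · have : (2 * (x * w)) ^ 2 = 4 * (a * (a + 3 * d)) := by
      rw [hw, mul_pow, mul_pow, ← hx]; ring
    rw [this]; ring
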